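/- In a unit-capacity network (u ≡ 1), let α > 0 and let x be a reroutable s-t-flow such that x(P) is an integer multiple of α for every path P ∈ 𝒫. Then there exists a strictly reroutable s-t-flow x' with val(x') = val(x), x'(a) ≤ x(a) for all arcs a ∈ A, and x'(P) an integer multiple of α for every P ∈ 𝒫. -/

import Mathlib

open scoped BigOperators

variable {V A : Type}

/-- `IsWalk tl hd v w L`: the list of arcs `L` forms a walk from `v` to `w`
in the digraph whose arcs `a` go from `tl a` to `hd a`. -/
def IsWalk (tl hd : A → V) : V → V → List A → Prop
  | v, w, [] => v = w
  | v, w, a :: L => tl a = v ∧ IsWalk tl hd (hd a) w L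

/-- A simple path from `v` to `w`: a walk visiting no vertex twice. -/
def IsPath (tl hd : A → V) (v w : V) (L : List A) : Prop :=
  IsWalk tl hd v w L ∧ (v :: L.map hd).Nodup

/-- `Before L b a`: the list `L` traverses `b` (strictly) before `a`. -/
def Before (L : List A) (b a : A) : Prop :=
  ∃ l₁ l₂ l₃ : List A, L = l₁ ++ b :: (l₂ ++ a :: l₃)

/-- Sum of a path-flow over a set of paths. -/
noncomputable def sumOver (x : List A → ℝ) (S : Set (List A)) : ℝ :=
  ∑ᶠ P ∈ S, x P

/-- Flow value `x(a)` on an arc `a`: total flow on `s`-`t`-paths through `a`. -/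
noncomputable def arcFlow (tl hd : A → V) (s t : V) (x : List A → ℝ) (a : A) : ℝ :=
  sumOver x {P | IsPath tl hd s t P ∧ a ∈ P}

/-- The value of a flow: total flow on all `s`-`t`-paths. -/
noncomputable def flowVal (tl hd : A → V) (s t : V) (x : List A → ℝ) : ℝ :=
  sumOver x {P | IsPath tl hd s t P}

/-- An `s`-`t`-(path-)flow: nonnegative, supported on simple `s`-`t`-paths,
respecting the arc capacities `u`. -/
def IsFlow (tl hd : A → V) (s t : V) (u : A → ℝ) (x : List A → ℝ) : Prop :=
  (∀ P, 0 ≤ x P) ∧ (∀ P, ¬ IsPath tl hd s t P → x P = 0) ∧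
    ∀ a : A, arcFlow tl hd s t x a ≤ u a

/-- Available capacity `ū_{x,b}(a)` of arc `a` after failure of arc `b`:
`u(a)` minus the flow on paths through `a` that do not traverse `b` before `a`. -/
noncomputable def availCap (tl hd : A → V) (s t : V) (u : A → ℝ) (x : List A → ℝ)
    (b a : A) : ℝ :=
  u a - sumOver x {P | IsPath tl hd s t P ∧ a ∈ P ∧ ¬ Before P b a}

/-- Arc flow of a rerouting flow `y` for failing arc `b`: `y` lives on
`tl b`-`t`-paths avoiding `b`. -/
noncomputable def reArcFlow (tl hd : A → V) (t : V) (b : A) (y : List A → ℝ) (a : A) : ℝ :=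
  sumOver y {Q | IsPath tl hd (tl b) t Q ∧ b ∉ Q ∧ a ∈ Q}

/-- Value of a rerouting flow `y` for failing arc `b`. -/
noncomputable def reVal (tl hd : A → V) (t : V) (b : A) (y : List A → ℝ) : ℝ :=
  sumOver y {Q | IsPath tl hd (tl b) t Q ∧ b ∉ Q}

/-- `y` is a rerouting of `x` for the failing arc `b`: a `tl b`-`t`-flow of value
`x(b)` in `(V, A ∖ {b})` with capacities `ū_{x,b}`. -/
def IsRerouting (tl hd : A → V) (s t : V) (u : A → ℝ) (x : List A → ℝ) (b : A)
    (y : List A → ℝ) : Prop :=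
  (∀ Q, 0 ≤ y Q) ∧
  (∀ Q, ¬ (IsPath tl hd (tl b) t Q ∧ b ∉ Q) → y Q = 0) ∧
  (∀ a : A, a ≠ b → reArcFlow tl hd t b y a ≤ availCap tl hd s t u x b a) ∧
  reVal tl hd t b y = arcFlow tl hd s t x b

/-- `y` is a strict rerouting of `x` for the failing arc `b`: a `tl b`-`t`-flow
of value `x(b)` in `(V, A ∖ {b})` with `y(a) ≤ u(a) - x(a)` for all `a ≠ b`. -/
def IsStrictRerouting (tl hd : A → V) (s t : V) (u : A → ℝ) (x : List A → ℝ) (b : A)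
    (y : List A → ℝ) : Prop :=
  (∀ Q, 0 ≤ y Q) ∧
  (∀ Q, ¬ (IsPath tl hd (tl b) t Q ∧ b ∉ Q) → y Q = 0) ∧
  (∀ a : A, a ≠ b → reArcFlow tl hd t b y a ≤ u a - arcFlow tl hd s t x a) ∧
  reVal tl hd t b y = arcFlow tl hd s t x b

/-- `x` is reroutable: a rerouting exists for every failing arc. -/
def Reroutable (tl hd : A → V) (s t : V) (u : A → ℝ) (x : List A → ℝ) : Prop :=
  ∀ b : A, ∃ y : List A → ℝ, IsRerouting tl hd s t u x b y

/-- `x` is strictly reroutable: a strict rerouting exists for every failing arc. -/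
def StrictlyReroutable (tl hd : A → V) (s t : V) (u : A → ℝ) (x : List A → ℝ) : Prop :=
  ∀ b : A, ∃ y : List A → ℝ, IsStrictRerouting tl hd s t u x b y


namespace Rer

variable {V A I : Type}

theorem walk_append {tl hd : A → V} {v w : V} {L₁ L₂ : List A} :
    IsWalk tl hd v w (L₁ ++ L₂) ↔ ∃ u, IsWalk tl hd v u L₁ ∧ IsWalk tl hd u w L₂ := by
  induction L₁ generalizing v with
  | nil => simp [IsWalk]
  | cons a L ih => simp [IsWalk, ih, and_assoc]

theorem walk_cross {tl hd : A → V} {v w : V} {L : List A} (S : Set V)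
    (h : IsWalk tl hd v w L) (hv : v ∈ S) (hw : w ∉ S) :
    ∃ a ∈ L, tl a ∈ S ∧ hd a ∉ S := by
  induction L generalizing v with
  | nil => simp only [IsWalk] at h; subst h; exact absurd hv hw
  | cons a L ih =>
    obtain ⟨h1, h2⟩ := h
    by_cases ha : hd a ∈ S
    · obtain ⟨c, hc, h3⟩ := ih h2 ha
      exact ⟨c, List.mem_cons_of_mem _ hc, h3⟩
    · exact ⟨a, List.mem_cons_self, h1 ▸ hv, ha⟩

theorem walk_split {tl hd : A → V} {u w v : V} {L : List A}
    (h : IsWalk tl hd u w L) (hv : v ∈ u :: L.map hd) :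
    ∃ L₁ L₂, L = L₁ ++ L₂ ∧ IsWalk tl hd u v L₁ ∧ IsWalk tl hd v w L₂ := by
  rcases List.mem_cons.1 hv with rfl | hv
  · exact ⟨[], L, rfl, rfl, h⟩
  · obtain ⟨a, ha, rfl⟩ := List.mem_map.1 hv
    obtain ⟨l1, l2, rfl⟩ := List.append_of_mem ha
    obtain ⟨z, h1, h2, h3⟩ := walk_append.1 h
    refine ⟨l1 ++ [a], l2, by simp, walk_append.2 ⟨z, h1, h2, rfl⟩, h3⟩

theorem walk_to_path {tl hd : A → V} {v w : V} {L : List A}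
    (h : IsWalk tl hd v w L) : ∃ Q, IsPath tl hd v w Q ∧ Q.Sublist L := by
  induction L generalizing v with
  | nil => exact ⟨[], ⟨h, by simp⟩, List.Sublist.refl _⟩
  | cons a L ih =>
    obtain ⟨Q, hQ, hs⟩ := ih h.2
    by_cases hv : v ∈ hd a :: Q.map hd
    · obtain ⟨L₁, L₂, rfl, h1, h2⟩ := walk_split hQ.1 hv
      refine ⟨L₂, ⟨h2, ?_⟩, ((List.sublist_append_right _ _).trans hs).cons _⟩
      have hn := hQ.2
      rcases L₁.eq_nil_or_concat with rfl | ⟨l, c, rfl⟩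
      · simp only [IsWalk] at h1; subst h1; simpa using hn
      · obtain ⟨z, _, h4, h5⟩ := walk_append.1 (by simpa using h1 : IsWalk tl hd (hd a) v (l ++ [c]))
        simp only [IsWalk] at h5
        subst h5
        refine hn.sublist ?_
        refine List.Sublist.cons _ ?_
        simp
    · exact ⟨a :: Q, ⟨⟨h.1, hQ.1⟩, by
        rw [List.map_cons]; exact List.nodup_cons.2 ⟨hv, hQ.2⟩⟩, hs.cons_cons a⟩

theorem path_nodup {tl hd : A → V} {v w : V} {L : List A}
    (h : IsPath tl hd v w L) : L.Nodup :=
  List.Nodup.of_map hd (List.nodup_cons.1 h.2).2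

/-- record arcs -/
def Rec (hd : A → V) (τ : V → ℕ∞) (P : List A) (a : A) : Prop :=
  ∃ l₁ l₂, P = l₁ ++ a :: l₂ ∧ ∀ c ∈ l₁, τ (hd a) < τ (hd c)

open Classical in
/-- number of indices satisfying p -/
noncomputable def num [Fintype I] (p : I → Prop) : ℕ := (Finset.univ.filter p).card

theorem num_le [Fintype I] {p q : I → Prop} (f : I → I) (hf : Function.Injective f)
    (h : ∀ i, p i → q (f i)) : num p ≤ num q := by
  classical
  unfold num
  refine Finset.card_le_card_of_injOn f ?_ hf.injOn
  intro i hi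
  simp only [Finset.coe_filter, Finset.mem_univ, true_and, Set.mem_ofPred_eq] at hi ⊢
  exact h i hi

structure Inv [Fintype I] (tl hd : A → V) (s t : V) (p : I → List A)
    (k : ℕ) (τ : V → ℕ∞) (pre tail : I → List A) (w : I → V) : Prop where
  lev : ∀ v, τ v = ⊤ ∨ τ v < k
  hs : τ s = ⊤
  pref : ∀ i, pre i <+: p i
  ptop : ∀ i, ∀ c ∈ pre i, τ (hd c) = ⊤
  pw : ∀ i, IsWalk tl hd s (w i) (pre i)
  tw : ∀ i, IsWalk tl hd (w i) t (tail i)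
  tfin : ∀ i, ∀ c ∈ tail i, τ (hd c) ≠ ⊤
  tnd : ∀ i, ((tail i).map hd).Nodup
  cnt : ∀ a, num (fun i => a ∈ tail i) ≤ num (fun i => Rec hd τ (p i) a)

theorem end_mem {tl hd : A → V} {s w : V} {L : List A} (h : IsWalk tl hd s w L) :
    w ∈ s :: L.map hd := by
  induction L generalizing s with
  | nil => simp only [IsWalk] at h; simp [h]
  | cons a L ih => have := ih h.2; simp at this ⊢; tauto

theorem end_eq {tl hd : A → V} {s w w' : V} {L : List A} (h : IsWalk tl hd s w L)
    (h' : IsWalk tl hd s w' L) : w = w' := by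
  induction L generalizing s with
  | nil => simp only [IsWalk] at h h'; rw [← h, ← h']
  | cons a L ih => exact ih h.2 h'.2

theorem exists_periodic [Finite V] (g : V → V) (v : V) : ∃ n, g^[n] v ∈ Function.periodicPts g := by
  have : ¬ Function.Injective (fun n : ℕ => g^[n] v) := not_injective_infinite_finite _
  simp only [Function.Injective, not_forall] at this
  obtain ⟨m, n, h, hne⟩ := this
  wlog hlt : m < n generalizing m n
  · exact this n m h.symm (Ne.symm hne) (by omega)
  refine ⟨m, n - m, by omega, ?_⟩
  rw [Function.IsPeriodicPt, Function.IsFixedPt, ← Function.iterate_add_apply, Nat.sub_add_cancel hlt.le]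
  exact h.symm

theorem core [Fintype V] [Fintype I] (tl hd : A → V) (s t : V) (p : I → List A)
    (hp : ∀ i, IsPath tl hd s t (p i)) (M : ℕ) :
    ∀ (k : ℕ) (τ : V → ℕ∞) (pre tail : I → List A) (w : I → V),
      Inv tl hd s t p k τ pre tail w →
      num (fun v => τ v = ⊤) + ∑ i, (pre i).length = M →
      ∃ (q : I → List A) (τ : V → ℕ∞), (∀ i, IsPath tl hd s t (q i)) ∧
        ∀ a, num (fun i => a ∈ q i) ≤ num (fun i => Rec hd τ (p i) a) := by
  classical
  induction M using Nat.strong_induction_on with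
  | _ M ih =>
  intro k τ pre tail w inv hM
  have pnd : ∀ i, (s :: (pre i).map hd).Nodup := fun i =>
    (hp i).2.sublist (((inv.pref i).sublist.map hd).cons_cons s)
  have wtop : ∀ i, τ (w i) = ⊤ := by
    intro i
    rcases List.mem_cons.1 (end_mem (inv.pw i)) with h | h
    · rw [h, inv.hs]
    · obtain ⟨c, hc, h⟩ := List.mem_map.1 h
      rw [← h]; exact inv.ptop i c hc
  by_cases hv : ∃ v, τ v = ⊤ ∧ ∀ i, v ∈ s :: (pre i).map hd → w i = v
  · obtain ⟨v, hvt, hv⟩ := hv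
    by_cases hvs : v = s
    · subst hvs
      have hw : ∀ i, w i = v := fun i => hv i (by simp)
      refine ⟨tail, τ, fun i => ⟨hw i ▸ inv.tw i, ?_⟩, inv.cnt⟩
      refine List.nodup_cons.2 ⟨?_, inv.tnd i⟩
      intro h
      obtain ⟨c, hc, h⟩ := List.mem_map.1 h
      exact inv.tfin i c hc (h ▸ inv.hs)
    · -- add v
      have hex : ∀ i, ∃ (l : List A) (T : List A) (w' : V), l <+: pre i ∧
          (∀ c ∈ l, hd c ≠ v) ∧ IsWalk tl hd s w' l ∧ IsWalk tl hd w' t T ∧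
          ((l = pre i ∧ T = tail i) ∨
            ∃ c, pre i = l ++ [c] ∧ T = c :: tail i ∧ hd c = v) := by
        intro i
        by_cases hwi : w i = v
        · rcases (pre i).eq_nil_or_concat with h0 | ⟨l, c, h0⟩
          · have := inv.pw i
            rw [h0] at this
            simp only [IsWalk] at this
            exact absurd (hwi.symm.trans this.symm) hvs
          · have h1 := inv.pw i
            have h0' : pre i = l ++ [c] := by simpa using h0
            rw [h0'] at h1
            obtain ⟨z, h2, h3, h4⟩ := walk_append.1 h1
            simp only [IsWalk] at h4
            refine ⟨l, c :: tail i, z, ⟨[c], h0'.symm⟩, ?_, h2, ⟨h3, h4 ▸ inv.tw i⟩, 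
              Or.inr ⟨c, h0', rfl, h4.trans hwi⟩⟩
            intro d hd1 hd2
            have := (List.nodup_cons.1 (pnd i)).2
            rw [h0', List.map_append, List.nodup_append] at this
            exact this.2.2 (hd d) (List.mem_map_of_mem hd1) (hd c) (by simp) (by rw [hd2, h4, hwi])
        · refine ⟨pre i, tail i, w i, List.prefix_refl _, ?_, inv.pw i, inv.tw i, Or.inl ⟨rfl, rfl⟩⟩
          intro c hc h
          exact hwi (hv i (List.mem_cons_of_mem _ (h ▸ List.mem_map_of_mem hc)))
      choose pre' tail' w' h1 h2 h3 h4 h5 using hex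
      have hne : ∀ u, τ u ≠ ⊤ → u ≠ v := fun u hu h => hu (h ▸ hvt)
      refine ih _ ?_ (k + 1) (Function.update τ v k) pre' tail' w' ?_ rfl
      · rw [← hM]
        refine add_lt_add_of_lt_of_le ?_ (Finset.sum_le_sum fun i _ => (h1 i).length_le)
        refine Finset.card_lt_card ?_
        refine Finset.ssubset_iff_subset_ne.2 ⟨?_, ?_⟩
        · intro u
          simp only [Finset.mem_filter, Finset.mem_univ, true_and, Function.update_apply]
          split_ifs with h
          · simp
          · exact id
        · intro h
          have := (Finset.ext_iff.1 h v).2 (by simp [hvt])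
          simp at this
      · constructor
        · intro u
          simp only [Function.update_apply]
          split_ifs with h
          · right; exact_mod_cast Nat.lt_succ_self k
          · rcases inv.lev u with h | h
            · exact Or.inl h
            · right; refine h.trans ?_; exact_mod_cast Nat.lt_succ_self k
        · rw [Function.update_of_ne (Ne.symm hvs)]; exact inv.hs
        · exact fun i => (h1 i).trans (inv.pref i)
        · intro i c hc
          rw [Function.update_of_ne (h2 i c hc)]
          exact inv.ptop i c ((h1 i).subset hc)
        · exact h3
        · exact h4
        · intro i c hc
          have key : c ∈ tail i → Function.update τ v (k : ℕ∞) (hd c) ≠ ⊤ := fun hc => by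
            rw [Function.update_of_ne (hne _ (inv.tfin i c hc))]; exact inv.tfin i c hc
          rcases h5 i with ⟨_, h⟩ | ⟨d, _, h, hdv⟩
          · exact key (h ▸ hc)
          · rw [h] at hc
            rcases List.mem_cons.1 hc with rfl | hc
            · rw [hdv]; simp
            · exact key hc
        · intro i
          rcases h5 i with ⟨_, h⟩ | ⟨d, _, h, hdv⟩
          · rw [h]; exact inv.tnd i
          · rw [h, List.map_cons]
            refine List.nodup_cons.2 ⟨?_, inv.tnd i⟩
            intro hm
            obtain ⟨c, hc, hcd⟩ := List.mem_map.1 hm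
            exact hne _ (inv.tfin i c hc) (hcd.trans hdv)
        · intro a
          by_cases hav : hd a = v
          · refine num_le id Function.injective_id fun i hi => ?_
            rcases h5 i with ⟨_, h⟩ | ⟨d, hd1, h, hdv⟩
            · rw [h] at hi
              exact absurd hav (hne _ (inv.tfin i a hi))
            · rw [h] at hi
              rcases List.mem_cons.1 hi with rfl | hi
              · obtain ⟨r, hr⟩ := inv.pref i
                refine ⟨pre' i, r, by rw [id, ← hr, hd1]; simp, ?_⟩
                intro c hc
                rw [hav, Function.update_self, Function.update_of_ne (h2 i c hc),
                  inv.ptop i c ((h1 i).subset hc)]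
                exact ENat.natCast_lt_top k
              · exact absurd hav (hne _ (inv.tfin i a hi))
          · have e1 : num (fun i => a ∈ tail' i) ≤ num (fun i => a ∈ tail i) := by
              refine num_le id Function.injective_id fun i hi => ?_
              rcases h5 i with ⟨_, h⟩ | ⟨d, hd1, h, hdv⟩
              · rwa [h] at hi
              · rw [h] at hi
                rcases List.mem_cons.1 hi with rfl | hi
                · exact absurd hdv hav
                · exact hi
            by_cases hat : τ (hd a) = ⊤
            · refine e1.trans (num_le id Function.injective_id fun i hi => ?_)
              exact absurd hat (inv.tfin i a hi)
            · refine (e1.trans (inv.cnt a)).trans (num_le id Function.injective_id fun i hi => ?_)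
              obtain ⟨l1, l2, hl, hc⟩ := hi
              refine ⟨l1, l2, hl, fun c hcl => ?_⟩
              rw [Function.update_of_ne hav]
              by_cases hcv : hd c = v
              · rw [hcv, Function.update_self]
                exact (inv.lev _).resolve_left hat
              · rw [Function.update_of_ne hcv]; exact hc c hcl
  · push Not at hv
    have hv' : ∀ v : {v // τ v = ⊤}, ∃ i, v.1 ∈ s :: (pre i).map hd ∧ w i ≠ v.1 := fun v => hv v.1 v.2
    choose φ hφ1 hφ2 using hv'
    let g : {v // τ v = ⊤} → {v // τ v = ⊤} := fun v => ⟨w (φ v), wtop _⟩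
    have hbij := Function.bijOn_periodicPts g
    set O := Function.periodicPts g with hO
    obtain ⟨n0, hn0⟩ := exists_periodic g ⟨s, inv.hs⟩
    have hφinj : Set.InjOn φ O := fun a ha b hb h => hbij.injOn ha hb (by simp only [g, h])
    have hsurj : ∀ v : {v // τ v = ⊤}, ∃ u, v ∈ O → u ∈ O ∧ g u = v := by
      intro v
      by_cases h : v ∈ O
      · obtain ⟨u, hu, hu'⟩ := hbij.surjOn h
        exact ⟨u, fun _ => ⟨hu, hu'⟩⟩
      · exact ⟨v, fun h' => absurd h' h⟩
    choose gi hgi using hsurj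
    have hex : ∀ i, ∃ (l : List A) (j : I) (w' : V), l <+: pre i ∧ IsWalk tl hd s w' l ∧
        IsWalk tl hd w' t (tail j) ∧
        ((∃ v ∈ O, φ v = i ∧ j = φ (gi v) ∧ l.length < (pre i).length) ∨
          ((¬ ∃ v ∈ O, φ v = i) ∧ j = i)) := by
      intro i
      by_cases h : ∃ v ∈ O, φ v = i
      · obtain ⟨v, hvO, rfl⟩ := h
        obtain ⟨L1, L2, hL, hw1, hw2⟩ := walk_split (inv.pw (φ v)) (hφ1 v)
        refine ⟨L1, φ (gi v), v.1, ⟨L2, hL.symm⟩, hw1, ?_, Or.inl ⟨v, hvO, rfl, rfl, ?_⟩⟩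
        · have := inv.tw (φ (gi v))
          rwa [show w (φ (gi v)) = v.1 from congrArg Subtype.val (hgi v hvO).2] at this
        · rw [hL, List.length_append]
          rcases L2 with _ | ⟨c, L2⟩
          · simp only [IsWalk] at hw2
            exact absurd hw2.symm (hφ2 v)
          · simp
      · exact ⟨pre i, i, w i, List.prefix_refl _, inv.pw i, inv.tw i, Or.inr ⟨h, rfl⟩⟩
    choose pre' σ w' h1 h2 h3 h4 using hex
    have hσ : Function.Injective σ := by
      intro i j hij
      rcases h4 i with ⟨v, hvO, hvi, hj, _⟩ | ⟨hn, hj⟩ <;>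
        rcases h4 j with ⟨v', hvO', hvi', hj', _⟩ | ⟨hn', hj'⟩
      · rw [hj, hj'] at hij
        have := hφinj (hgi v hvO).1 (hgi v' hvO').1 hij
        rw [← hvi, ← hvi', ← (hgi v hvO).2, ← (hgi v' hvO').2, this]
      · exact absurd ⟨_, (hgi v hvO).1, by rw [← hj, hij, hj']⟩ hn'
      · exact absurd ⟨_, (hgi v' hvO').1, by rw [← hj', ← hij, hj]⟩ hn
      · rw [← hj, ← hj', hij]
    refine ih _ ?_ k τ pre' (fun i => tail (σ i)) w' ?_ rfl
    · rw [← hM]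
      refine Nat.add_lt_add_left (Finset.sum_lt_sum (fun i _ => (h1 i).length_le) 
        ⟨φ (g^[n0] ⟨s, inv.hs⟩), Finset.mem_univ _, ?_⟩) _
      · rcases h4 (φ (g^[n0] ⟨s, inv.hs⟩)) with ⟨_, _, _, _, h⟩ | ⟨h, _⟩
        · exact h
        · exact absurd ⟨_, hn0, rfl⟩ h
    · exact ⟨inv.lev, inv.hs, fun i => (h1 i).trans (inv.pref i),
        fun i c hc => inv.ptop i c ((h1 i).subset hc), h2, h3, fun i => inv.tfin _,
        fun i => inv.tnd _, fun a => (num_le σ hσ fun i hi => hi).trans (inv.cnt a)⟩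

theorem core' [Fintype V] [Fintype I] (tl hd : A → V) (s t : V) (p : I → List A)
    (hp : ∀ i, IsPath tl hd s t (p i)) :
      ∃ (q : I → List A) (τ : V → ℕ∞), (∀ i, IsPath tl hd s t (q i)) ∧
        ∀ a, num (fun i => a ∈ q i) ≤ num (fun i => Rec hd τ (p i) a) := by
  refine core tl hd s t p hp _ 0 (fun _ => ⊤) p (fun _ => []) (fun _ => t) ?_ rfl
  constructor <;> try simp [IsWalk]
  · exact fun i => (hp i).1
  · intro a
    simp [num]

theorem finite_nodup [Fintype A] : {L : List A | L.Nodup}.Finite :=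
  (List.finite_length_le A (Fintype.card A)).subset fun _ hL => List.Nodup.length_le_card hL

open Classical in
theorem sumOver_eq {Pr : List A → Prop} [Fintype {Q // Pr Q}] (y : List A → ℝ)
    (S : Set (List A)) (hS : ∀ Q ∈ S, Pr Q) :
    sumOver y S = ∑ q : {Q // Pr Q}, if q.1 ∈ S then y q.1 else 0 := by
  have : S = ↑((Finset.univ.filter (fun q : {Q // Pr Q} => q.1 ∈ S)).map
      (Function.Embedding.subtype Pr)) := by
    ext Q
    simp
    exact fun h => hS Q h
  unfold sumOver
  conv_lhs => rw [this]
  rw [finsum_mem_coe_finset, Finset.sum_map, Finset.sum_filter]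
  rfl

open Classical in
theorem cut_dist [Fintype A] [DecidableEq A] (tl hd : A → V) (v t : V) (b : A)
    (c l : A → ℝ) (hc : ∀ a, 0 ≤ c a) (hl : ∀ a, 0 ≤ l a) (w D : ℝ) 
    (hD : ∀ Q, IsPath tl hd v t Q → b ∉ Q → D ≤ (Q.map l).sum) (hD0 : 0 ≤ D)
    (hcut : ∀ S : Set V, v ∈ S → t ∉ S →
      w ≤ ∑ a, if a ≠ b ∧ tl a ∈ S ∧ hd a ∉ S then c a else 0) :
    w * D ≤ ∑ a, if a ≠ b then l a * c a else 0 := by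
  let W : V → Set ℝ := fun u => insert D {r | ∃ L, IsWalk tl hd v u L ∧ b ∉ L ∧ r = (L.map l).sum}
  have Wpos : ∀ u, ∀ r ∈ W u, 0 ≤ r := by
    rintro u r (rfl | ⟨L, _, _, rfl⟩)
    · exact hD0
    · refine List.sum_nonneg ?_
      intro x hx
      obtain ⟨a, _, rfl⟩ := List.mem_map.1 hx
      exact hl a
  have Wne : ∀ u, (W u).Nonempty := fun u => ⟨D, Set.mem_insert _ _⟩
  have Wbdd : ∀ u, BddBelow (W u) := fun u => ⟨0, fun r hr => Wpos u r hr⟩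
  let d : V → ℝ := fun u => sInf (W u)
  have d0 : d v ≤ 0 := csInf_le (Wbdd v) (Or.inr ⟨[], rfl, by simp, by simp⟩)
  have dt : D ≤ d t := by
    refine le_csInf (Wne t) ?_
    rintro r (rfl | ⟨L, hL, hb, rfl⟩)
    · exact le_rfl
    · obtain ⟨Q, hQ, hs⟩ := walk_to_path hL
      refine (hD Q hQ (fun h => hb (hs.subset h))).trans ?_
      refine (hs.map l).sum_le_sum ?_
      intro x hx
      obtain ⟨a, _, rfl⟩ := List.mem_map.1 hx
      exact hl a
  have dstep : ∀ a, a ≠ b → d (hd a) ≤ d (tl a) + l a := by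
    intro a hab
    rw [← sub_le_iff_le_add]
    refine le_csInf (Wne _) ?_
    rintro r (rfl | ⟨L, hL, hb, rfl⟩)
    · have := csInf_le (Wbdd (hd a)) (Set.mem_insert r _)
      have := hl a
      simp only [d]; linarith
    · have : d (hd a) ≤ ((L ++ [a]).map l).sum := by
        refine csInf_le (Wbdd (hd a)) (Or.inr ⟨L ++ [a], walk_append.2 ⟨_, hL, rfl, rfl⟩, ?_, rfl⟩)
        simp [hb, Ne.symm hab]
      simp at this
      linarith
  let F : A → ℝ → ℝ := fun a => (Set.Ico (d (tl a)) (d (hd a))).indicator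
    (fun _ => if a ≠ b then c a else 0)
  have Fint : ∀ a, MeasureTheory.Integrable (F a) MeasureTheory.volume := by
    intro a
    refine (MeasureTheory.integrable_indicator_iff measurableSet_Ico).2 ?_
    exact MeasureTheory.integrableOn_const (by simp)
  have Fval : ∀ a, ∫ θ, F a θ ≤ if a ≠ b then l a * c a else 0 := by
    intro a
    simp only [F]
    rw [MeasureTheory.integral_indicator measurableSet_Ico, MeasureTheory.setIntegral_const]
    split_ifs with h
    · rw [smul_eq_mul]
      refine mul_le_mul_of_nonneg_right ?_ (hc a)
      simp only [Real.volume_real_Ico]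
      exact max_le (by linarith [dstep a h]) (hl a)
    · simp
  have Fnn : ∀ a θ, 0 ≤ F a θ := by
    intro a θ
    refine Set.indicator_nonneg ?_ θ
    intro _ _
    split_ifs
    · exact hc a
    · exact le_rfl
  have Fge : ∀ θ ∈ Set.Ico 0 D, w ≤ ∑ a, F a θ := by
    intro θ hθ
    refine (hcut {u | d u ≤ θ} (d0.trans hθ.1) (fun h => ?_)).trans (le_of_eq ?_)
    · exact absurd (dt.trans h) (not_le.2 hθ.2)
    · refine Finset.sum_congr rfl fun a _ => ?_
      simp only [F, Set.indicator_apply, Set.mem_Ico, Set.mem_ofPred_eq, not_le]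
      split_ifs <;> first | rfl | tauto
  calc w * D = ∫ θ in Set.Ico 0 D, w := by
        rw [MeasureTheory.setIntegral_const, Real.volume_real_Ico]
        simp [hD0, mul_comm]
    _ ≤ ∫ θ in Set.Ico 0 D, ∑ a, F a θ := by
        refine MeasureTheory.setIntegral_mono_on (MeasureTheory.integrableOn_const (by simp)) 
          (MeasureTheory.integrable_finsetSum _ fun a _ => Fint a).integrableOn measurableSet_Ico Fge
    _ ≤ ∫ θ, ∑ a, F a θ := 
        MeasureTheory.setIntegral_le_integral (MeasureTheory.integrable_finsetSum _ fun a _ => Fint a)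
          (Filter.Eventually.of_forall fun θ => Finset.sum_nonneg fun a _ => Fnn a θ)
    _ = ∑ a, ∫ θ, F a θ := MeasureTheory.integral_finsetSum _ fun a _ => Fint a
    _ ≤ _ := Finset.sum_le_sum fun a _ => Fval a

open Classical in
theorem mfmc [Fintype A] [DecidableEq A] (tl hd : A → V) (v t : V) (b : A)
    (c : A → ℝ) (hc : ∀ a, 0 ≤ c a) (w : ℝ) (hw : 0 < w)
    (hcut : ∀ S : Set V, v ∈ S → t ∉ S →
      w ≤ ∑ a, if a ≠ b ∧ tl a ∈ S ∧ hd a ∉ S then c a else 0) :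
    ∃ y : List A → ℝ, (∀ Q, 0 ≤ y Q) ∧ (∀ Q, ¬ (IsPath tl hd v t Q ∧ b ∉ Q) → y Q = 0) ∧
      (∀ a, a ≠ b → sumOver y {Q | IsPath tl hd v t Q ∧ b ∉ Q ∧ a ∈ Q} ≤ c a) ∧
      sumOver y {Q | IsPath tl hd v t Q ∧ b ∉ Q} = w := by
  have hfin : Finite {Q // IsPath tl hd v t Q ∧ b ∉ Q} :=
    (finite_nodup.subset (t := {Q : List A | IsPath tl hd v t Q ∧ b ∉ Q})
      (fun Q hQ => path_nodup hQ.1)).to_subtype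
  have := Fintype.ofFinite {Q // IsPath tl hd v t Q ∧ b ∉ Q}
  set X := {Q // IsPath tl hd v t Q ∧ b ∉ Q} with hX
  let Φ : (X → ℝ) →ₗ[ℝ] (A → ℝ) :=
    { toFun := fun y a => ∑ q : X, if a ∈ q.1 then y q else 0
      map_add' := by
        intro y z; ext a
        simp only [Pi.add_apply, ← Finset.sum_add_distrib]
        refine Finset.sum_congr rfl fun q _ => ?_
        split_ifs <;> simp
      map_smul' := by
        intro r y; ext a
        simp only [Pi.smul_apply, smul_eq_mul, Finset.mul_sum, RingHom.id_apply]
        refine Finset.sum_congr rfl fun q _ => ?_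
        split_ifs <;> simp }
  let T : Set (A → ℝ) := {z | ∀ a, a ≠ b → w * z a ≤ c a}
  by_cases hdis : Disjoint (Φ '' stdSimplex ℝ X) T
  · exfalso
    have hTc : Convex ℝ T := by
      intro z hz z' hz' p q hp hq hpq a hab
      have h1 := mul_le_mul_of_nonneg_left (hz a hab) hp
      have h2 := mul_le_mul_of_nonneg_left (hz' a hab) hq
      simp only [Pi.add_apply, Pi.smul_apply, smul_eq_mul]
      calc w * (p * z a + q * z' a) = p * (w * z a) + q * (w * z' a) := by ring
        _ ≤ p * c a + q * c a := add_le_add h1 h2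
        _ = c a := by rw [← add_mul, hpq, one_mul]
    have hTcl : IsClosed T := by
      have : T = ⋂ a, {z : A → ℝ | a ≠ b → w * z a ≤ c a} := by ext; simp [T]
      rw [this]
      refine isClosed_iInter fun a => ?_
      by_cases hab : a = b
      · simp [hab]
      · simp only [ne_eq, hab, not_false_eq_true, forall_const]
        exact isClosed_le (by fun_prop) continuous_const
    obtain ⟨f, u, r, hf1, hur, hf2⟩ := geometric_hahn_banach_compact_closed
      ((convex_stdSimplex ℝ X).linear_image Φ)
      ((isCompact_stdSimplex ℝ X).image (LinearMap.continuous_of_finiteDimensional Φ)) hTc hTcl hdis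
    let l : A → ℝ := fun a => - f (Pi.single a 1)
    have hf : ∀ z, f z = - ∑ a, z a * l a := by
      intro z
      conv_lhs => rw [← Finset.univ_sum_single z, map_sum]
      rw [← Finset.sum_neg_distrib]
      refine Finset.sum_congr rfl fun a _ => ?_
      have : Pi.single a (z a) = z a • (Pi.single a (1 : ℝ) : A → ℝ) := by
        rw [← Pi.single_smul]; simp
      rw [this, map_smul]; simp [l]
    let z0 : A → ℝ := fun a => c a / w
    have hz0 : ∀ a, w * z0 a = c a := fun a => by simp only [z0]; field_simp
    have hmove : ∀ a (m : ℝ), (a ≠ b → m ≤ 0) → r < f z0 - m * l a := by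
      intro a m hm
      have : z0 + m • (Pi.single a (1 : ℝ) : A → ℝ) ∈ T := by
        intro a' ha'
        simp only [Pi.add_apply, Pi.smul_apply, smul_eq_mul, mul_add, hz0]
        by_cases h : a' = a
        · subst h
          simp
          exact mul_nonpos_of_nonneg_of_nonpos hw.le (hm ha')
        · simp [h]
      have := hf2 _ this
      rw [map_add, map_smul] at this
      simp only [smul_eq_mul] at this
      simp only [l]; linarith
    have hr0 : r < f z0 := by simpa using hmove b 0 (by simp)
    have hl : ∀ a, 0 ≤ l a := by
      intro a
      by_contra h
      push Not at h
      have := hmove a (-((f z0 - r) / (- l a))) (fun _ => by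
        rw [neg_nonpos]; exact div_nonneg (by linarith) (by linarith))
      have e : -((f z0 - r) / (- l a)) * l a = f z0 - r := by
        have : l a ≠ 0 := h.ne
        field_simp
      rw [e] at this
      linarith
    have hlb : l b = 0 := by
      refine le_antisymm ?_ (hl b)
      by_contra h
      push Not at h
      have := hmove b ((f z0 - r) / l b) (fun h => absurd rfl h)
      rw [div_mul_cancel₀ _ h.ne'] at this
      linarith
    have hz : f z0 ≤ 0 := by
      rw [hf, neg_nonpos]
      exact Finset.sum_nonneg fun a _ => mul_nonneg (div_nonneg (hc a) hw.le) (hl a)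
    have key := cut_dist tl hd v t b c l hc hl w (-u) ?_ (by linarith) hcut
    · have e : (∑ a, if a ≠ b then l a * c a else 0) = w * (- f z0) := by
        rw [hf, neg_neg, Finset.mul_sum]
        refine Finset.sum_congr rfl fun a _ => ?_
        rw [← mul_assoc, hz0]
        split_ifs with h
        · ring
        · have : a = b := by tauto
          rw [this, hlb, mul_zero]
      rw [e] at key
      have := le_of_mul_le_mul_left key hw
      linarith
    · intro Q hQ hb
      have := hf1 _ ⟨Pi.single (⟨Q, hQ, hb⟩ : X) 1, single_mem_stdSimplex ℝ _, rfl⟩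
      rw [hf] at this
      have e : ∑ a, Φ (Pi.single (⟨Q, hQ, hb⟩ : X) 1) a * l a = (Q.map l).sum := by
        rw [← List.sum_toFinset _ (path_nodup hQ), ← Finset.sum_filter_add_sum_filter_not Finset.univ (fun a => a ∈ Q)]
        have e1 : ∀ a, Φ (Pi.single (⟨Q, hQ, hb⟩ : X) 1) a = if a ∈ Q then 1 else 0 := by
          intro a
          show (∑ q : X, if a ∈ q.1 then (Pi.single (⟨Q, hQ, hb⟩ : X) (1:ℝ) : X → ℝ) q else 0) = _
          rw [Finset.sum_eq_single (⟨Q, hQ, hb⟩ : X)]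
          · simp
          · intro q _ hq
            simp [hq]
          · simp
        simp only [e1]
        rw [Finset.sum_congr rfl (g := l) (by intro a ha; simp at ha; simp [ha]),
          Finset.sum_eq_zero (s := Finset.univ.filter (fun a => ¬ a ∈ Q)) 
            (by intro a ha; simp at ha; simp [ha]), add_zero]
        refine Finset.sum_congr ?_ fun _ _ => rfl
        ext; simp
      rw [e] at this
      linarith
  · obtain ⟨_, ⟨z, hz, rfl⟩, hzT⟩ := Set.not_disjoint_iff.1 hdis
    let y : List A → ℝ := fun Q => if h : IsPath tl hd v t Q ∧ b ∉ Q then w * z ⟨Q, h⟩ else 0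
    have hy : ∀ q : X, y q.1 = w * z q := fun q => dif_pos q.2
    refine ⟨y, ?_, ?_, ?_, ?_⟩
    · intro Q
      simp only [y]
      split_ifs with h
      · exact mul_nonneg hw.le (hz.1 _)
      · exact le_rfl
    · intro Q hQ
      exact dif_neg hQ
    · intro a hab
      refine le_trans (le_of_eq ?_) (hzT a hab)
      rw [sumOver_eq (Pr := fun Q => IsPath tl hd v t Q ∧ b ∉ Q) y _ (fun Q h => ⟨h.1, h.2.1⟩)]
      show _ = w * ∑ q : X, if a ∈ q.1 then z q else 0
      rw [Finset.mul_sum]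
      refine Finset.sum_congr rfl fun q _ => ?_
      have h1 := q.2.1
      have h2 := q.2.2
      simp only [Set.mem_ofPred_eq, h1, h2, hy, true_and, not_false_eq_true]
      split_ifs <;> simp
    · rw [sumOver_eq (Pr := fun Q => IsPath tl hd v t Q ∧ b ∉ Q) y {Q | IsPath tl hd v t Q ∧ b ∉ Q} (fun Q h => h)]
      have : ∑ q : X, w * z q = w := by rw [← Finset.mul_sum, hz.2, mul_one]
      refine Eq.trans ?_ this
      refine Finset.sum_congr rfl fun q _ => ?_
      rw [if_pos (show q.1 ∈ {Q | IsPath tl hd v t Q ∧ b ∉ Q} from q.2)]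
      exact hy q

/-- path flow given by a family of paths -/
noncomputable def fl [Fintype I] (α : ℝ) (q : I → List A) : List A → ℝ :=
  fun Q => α * num (fun i => q i = Q)

open Classical in
theorem num_cast [Fintype I] (p : I → Prop) : (num p : ℝ) = ∑ i, if p i then (1 : ℝ) else 0 := by
  simp [num]

theorem sumOver_fl [Fintype I] {Pr : List A → Prop} [Fintype {Q // Pr Q}] (α : ℝ)
    (q : I → List A) (hq : ∀ i, Pr (q i))
    (S : Set (List A)) (hS : ∀ Q ∈ S, Pr Q) :
    sumOver (fl α q) S = α * num (fun i => q i ∈ S) := by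
  classical
  rw [sumOver_eq (Pr := Pr) _ S hS, num_cast, Finset.mul_sum]
  simp only [fl, num_cast, Finset.mul_sum, ← Finset.sum_filter]
  rw [Finset.sum_comm]
  refine Finset.sum_congr rfl fun i _ => ?_
  rw [Finset.sum_filter]
  rw [Finset.sum_eq_single (⟨q i, hq i⟩ : {Q // Pr Q})]
  · simp
  · rintro ⟨r, hr⟩ _ hne
    have : q i ≠ r := fun h => hne (by simp [h])
    simp [this]
  · simp

theorem before_rec {tl hd : A → V} {s t : V} {τ : V → ℕ∞} {P : List A} {a b : A}
    (hP : IsPath tl hd s t P) (hr : Rec hd τ P a) (hτ : τ (hd b) ≤ τ (hd a)) :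
    ¬ Before P b a := by
  rintro ⟨m1, m2, m3, hm⟩
  obtain ⟨l1, l2, hl, h⟩ := hr
  have hn := path_nodup hP
  have hb : b ∈ l1 := by
    have e : (m1 ++ b :: m2) ++ a :: m3 = l1 ++ a :: l2 := by rw [← hl, hm]; simp
    have n1 : a ∉ m1 ++ b :: m2 := by
      rw [hm, show m1 ++ b :: (m2 ++ a :: m3) = (m1 ++ b :: m2) ++ a :: m3 by simp,
        List.nodup_append] at hn
      exact fun h => hn.2.2 a h a (by simp) rfl
    have n2 : a ∉ l1 := by
      rw [hl, List.nodup_append] at hn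
      exact fun h => hn.2.2 a h a (by simp) rfl
    rcases List.append_eq_append_iff.1 e with ⟨r, h1, h2⟩ | ⟨r, h1, h2⟩
    · rw [h1]; simp
    · rcases r with _ | ⟨c, r⟩
      · rw [List.append_nil] at h1; rw [← h1]; simp
      · simp only [List.cons_append, List.cons.injEq] at h2
        exact absurd (by rw [h1, h2.1]; simp) n1
  exact absurd (h b hb) (not_lt.2 hτ)

open Classical in
theorem reVal_le [Fintype A] [DecidableEq A] (tl hd : A → V) (t : V) (b : A) (y : List A → ℝ)
    (hy : ∀ Q, 0 ≤ y Q) (S : Set V) (hv : tl b ∈ S) (ht : t ∉ S) :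
    reVal tl hd t b y ≤
      ∑ a ∈ (Finset.univ.filter (fun a => tl a ∈ S ∧ hd a ∉ S)).erase b, reArcFlow tl hd t b y a := by
  have hfin : Finite {Q // IsPath tl hd (tl b) t Q ∧ b ∉ Q} :=
    (finite_nodup.subset (t := {Q : List A | IsPath tl hd (tl b) t Q ∧ b ∉ Q})
      (fun Q hQ => path_nodup hQ.1)).to_subtype
  have := Fintype.ofFinite {Q // IsPath tl hd (tl b) t Q ∧ b ∉ Q}
  unfold reVal reArcFlow
  rw [sumOver_eq (Pr := fun Q => IsPath tl hd (tl b) t Q ∧ b ∉ Q) y {Q | IsPath tl hd (tl b) t Q ∧ b ∉ Q} (fun Q h => h)]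
  simp_rw [fun a => sumOver_eq (Pr := fun Q => IsPath tl hd (tl b) t Q ∧ b ∉ Q) y
    {Q | IsPath tl hd (tl b) t Q ∧ b ∉ Q ∧ a ∈ Q} (fun Q h => ⟨h.1, h.2.1⟩)]
  rw [Finset.sum_comm]
  refine Finset.sum_le_sum fun q _ => ?_
  rw [if_pos (show q.1 ∈ {Q | IsPath tl hd (tl b) t Q ∧ b ∉ Q} from q.2)]
  obtain ⟨a, ha, h1, h2⟩ := walk_cross S q.2.1.1 hv ht
  have hab : a ≠ b := fun h => q.2.2 (h ▸ ha)
  refine le_trans (le_of_eq ?_) (Finset.single_le_sum (a := a) ?_ ?_)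
  · exact (if_pos (show q.1 ∈ {Q | IsPath tl hd (tl b) t Q ∧ b ∉ Q ∧ a ∈ Q} from ⟨q.2.1, q.2.2, ha⟩)).symm
  · intro a _
    split_ifs
    · exact hy _
    · exact le_rfl
  · simp [hab, h1, h2]

end Rer

open Rer

/-- In a unit-capacity network, if `x` is a reroutable s-t-flow whose path
values are integer multiples of `α > 0`, then there is a strictly reroutable s-t-flow `x'`
with the same value, `x'(a) ≤ x(a)` on every arc, and all path values integer multiples
of `α`. -/
theorem unit_reroutable_to_strictlyReroutable_multiple
    {V A : Type} [Fintype V] [DecidableEq V] [Fintype A] [DecidableEq A]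
    (tl hd : A → V) (s t : V) (α : ℝ) (hα : 0 < α)
    (x : List A → ℝ) (hx : IsFlow tl hd s t (fun _ => (1 : ℝ)) x)
    (hrf : Reroutable tl hd s t (fun _ => (1 : ℝ)) x)
    (hmul : ∀ P : List A, ∃ n : ℤ, x P = n * α) :
    ∃ x' : List A → ℝ,
      IsFlow tl hd s t (fun _ => (1 : ℝ)) x' ∧
      StrictlyReroutable tl hd s t (fun _ => (1 : ℝ)) x' ∧
      flowVal tl hd s t x' = flowVal tl hd s t x ∧
      (∀ a : A, arcFlow tl hd s t x' a ≤ arcFlow tl hd s t x a) ∧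
      ∀ P : List A, ∃ n : ℤ, x' P = n * α := by
  classical
  have hfin : Finite {Q // IsPath tl hd s t Q} :=
    (finite_nodup.subset (t := {Q : List A | IsPath tl hd s t Q})
      (fun Q hQ => path_nodup hQ)).to_subtype
  have := Fintype.ofFinite {Q // IsPath tl hd s t Q}
  choose n hn using hmul
  have hn0 : ∀ P, 0 ≤ n P := by
    intro P
    have h := hx.1 P
    rw [hn P] at h
    by_contra hneg
    push Not at hneg
    have : (n P : ℝ) < 0 := by exact_mod_cast hneg
    nlinarith
  let I : Type := Σ P : {Q // IsPath tl hd s t Q}, Fin (n P.1).toNat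
  let p : I → List A := fun i => i.1.1
  have hp : ∀ i, IsPath tl hd s t (p i) := fun i => i.1.2
  have hxp : x = fl α p := by
    funext P
    by_cases hP : IsPath tl hd s t P
    · rw [fl, num_cast, hn P, mul_comm]
      congr 1
      rw [Fintype.sum_sigma, Finset.sum_eq_single (⟨P, hP⟩ : {Q // IsPath tl hd s t Q})]
      · simp only [p]
        simp
        have : ((n P).toNat : ℤ) = n P := Int.toNat_of_nonneg (hn0 P)
        exact_mod_cast this.symm
      · rintro ⟨r, hr⟩ _ hne
        have : r ≠ P := fun h => hne (by simp [h])
        simp [p, this]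
      · simp
    · rw [hx.2.1 P hP, fl, num_cast, Finset.sum_eq_zero, mul_zero]
      intro i _
      rw [if_neg]
      exact fun h => hP (h ▸ hp i)
  obtain ⟨q, τ, hq, hcnt⟩ := core' tl hd s t p hp
  have hSf : ∀ (r : I → List A), (∀ i, IsPath tl hd s t (r i)) → ∀ S : Set (List A),
      (∀ Q ∈ S, IsPath tl hd s t Q) → sumOver (fl α r) S = α * num (fun i => r i ∈ S) :=
    fun r hr S hS => sumOver_fl (Pr := IsPath tl hd s t) α r hr S hS
  have harc : ∀ (r : I → List A), (∀ i, IsPath tl hd s t (r i)) → ∀ a,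
      arcFlow tl hd s t (fl α r) a = α * num (fun i => a ∈ r i) := by
    intro r hr a
    rw [arcFlow, hSf r hr _ (fun Q h => h.1)]
    simp [hr]
  have hle : ∀ a (R : I → Prop), (∀ i, Rec hd τ (p i) a → R i) →
      arcFlow tl hd s t (fl α q) a ≤ α * num R := by
    intro a R hR
    rw [harc q hq]
    refine mul_le_mul_of_nonneg_left ?_ hα.le
    exact_mod_cast (hcnt a).trans (num_le id Function.injective_id hR)
  have hqx : ∀ a, arcFlow tl hd s t (fl α q) a ≤ arcFlow tl hd s t x a := by
    intro a
    rw [hxp, harc p hp]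
    refine hle a _ ?_
    rintro i ⟨l1, l2, h, _⟩
    rw [h]; simp
  have hq1 : ∀ a, arcFlow tl hd s t (fl α q) a ≤ 1 := fun a => (hqx a).trans (hx.2.2 a)
  have hq0 : ∀ a, 0 ≤ arcFlow tl hd s t (fl α q) a := by
    intro a; rw [harc q hq]; positivity
  have hcut : ∀ S : Set V, t ∉ S → (∃ a, tl a ∈ S ∧ hd a ∉ S) →
      1 ≤ ∑ a ∈ Finset.univ.filter (fun a => tl a ∈ S ∧ hd a ∉ S),
        (1 - arcFlow tl hd s t (fl α q) a) := by
    rintro S hS ⟨a0, ha0⟩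
    obtain ⟨b, hb, hmin⟩ := Finset.exists_min_image
      (Finset.univ.filter (fun a => tl a ∈ S ∧ hd a ∉ S)) (fun a => τ (hd a)) ⟨a0, by simpa using ha0⟩
    have hb' : tl b ∈ S ∧ hd b ∉ S := by simpa using hb
    obtain ⟨y, hy1, hy2, hy3, hy4⟩ := hrf b
    have h1 := reVal_le tl hd t b y hy1 S hb'.1 hS
    rw [hy4] at h1
    rw [← Finset.add_sum_erase _ _ hb]
    have h2 : ∑ a ∈ (Finset.univ.filter (fun a => tl a ∈ S ∧ hd a ∉ S)).erase b,
        reArcFlow tl hd t b y a ≤ ∑ a ∈ (Finset.univ.filter (fun a => tl a ∈ S ∧ hd a ∉ S)).erase b,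
        (1 - arcFlow tl hd s t (fl α q) a) := by
      refine Finset.sum_le_sum fun a ha => ?_
      obtain ⟨hab, ha⟩ := Finset.mem_erase.1 ha
      refine (hy3 a hab).trans ?_
      unfold availCap
      rw [hxp, hSf p hp _ (fun Q h => h.1)]
      refine sub_le_sub_left (hle a _ ?_) _
      intro i hi
      refine ⟨hp i, ?_, before_rec (hp i) hi (hmin a ha)⟩
      obtain ⟨l1, l2, h, _⟩ := hi
      rw [h]; simp
    have h3 := hqx b
    linarith
  refine ⟨fl α q, ⟨?_, ?_, hq1⟩, ?_, ?_, hqx, ?_⟩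
  · intro P; unfold fl; positivity
  · intro P hP
    rw [fl, num_cast, Finset.sum_eq_zero, mul_zero]
    intro i _
    rw [if_neg]
    exact fun h => hP (h ▸ hq i)
  · intro b
    rcases (hq0 b).eq_or_lt with h0 | hpos
    · refine ⟨fun _ => 0, fun _ => le_rfl, fun _ _ => rfl, ?_, ?_⟩
      · intro a _
        simp only [reArcFlow, sumOver, finsum_zero]
        linarith [hq1 a]
      · rw [← h0]; simp [reVal, sumOver]
    · obtain ⟨y, h1, h2, h3, h4⟩ := mfmc tl hd (tl b) t b
        (fun a => 1 - arcFlow tl hd s t (fl α q) a) (fun a => by linarith [hq1 a]) _ hpos (by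
          intro S hv ht
          by_cases hb : hd b ∈ S
          · have hex : ∃ a, tl a ∈ S ∧ hd a ∉ S := by
              have : ∃ i, b ∈ q i := by
                by_contra hno
                push Not at hno
                rw [harc q hq, num_cast] at hpos
                simp [hno] at hpos
              obtain ⟨i, hi⟩ := this
              obtain ⟨l1, l2, hl⟩ := List.append_of_mem hi
              have hw := (hq i).1
              rw [hl] at hw
              obtain ⟨z, _, _, hw2⟩ := walk_append.1 hw
              obtain ⟨a, _, ha⟩ := walk_cross S hw2 hb ht
              exact ⟨a, ha⟩
            refine (hq1 b).trans ((hcut S ht hex).trans (le_of_eq ?_))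
            rw [Finset.sum_filter]
            refine Finset.sum_congr rfl fun a _ => ?_
            refine if_congr ⟨fun h => ⟨?_, h⟩, fun h => h.2⟩ rfl rfl
            rintro rfl
            exact h.2 hb
          · have h := hcut S ht ⟨b, hv, hb⟩
            rw [← Finset.add_sum_erase _ _ (by simp [hv, hb] :
              b ∈ Finset.univ.filter (fun a => tl a ∈ S ∧ hd a ∉ S))] at h
            rw [← Finset.sum_filter]
            have e : (Finset.univ.filter (fun a => tl a ∈ S ∧ hd a ∉ S)).erase b =
                Finset.univ.filter (fun a => a ≠ b ∧ tl a ∈ S ∧ hd a ∉ S) := by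
              ext a; simp
            rw [e] at h
            linarith)
      exact ⟨y, h1, h2, h3, h4⟩
  · rw [hxp]
    unfold flowVal
    rw [hSf q hq {P | IsPath tl hd s t P} (fun Q h => h), hSf p hp {P | IsPath tl hd s t P} (fun Q h => h)]
    simp [hp, hq]
  · intro P
    exact ⟨(num (fun i => q i = P) : ℤ), by rw [fl, mul_comm]; simp⟩
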